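/- Let t be an integer, u² a rational number with 0 < u² < t − 1, and suppose the finite cusp set C(Δ(u²,2t)) equals all of ℚ (in particular, this holds if Δ(u²,2t) is pseudomodular). If the denominator of u² is an odd prime p, then p does not divide t. -/

import Mathlib

open Matrix

/-- The projective general linear group `PGL₂(ℚ)`. -/
abbrev PGL2Q : Type := GL (Fin 2) ℚ ⧸ Subgroup.center (GL (Fin 2) ℚ)

/-- The canonical projection `GL₂(ℚ) → PGL₂(ℚ)`. -/
def pgl : GL (Fin 2) ℚ →* PGL2Q := QuotientGroup.mk' (Subgroup.center (GL (Fin 2) ℚ))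

/-- The Möbius action of a matrix `A ∈ GL₂(ℚ)` on `ℙ¹(ℚ) = ℚ ∪ {∞}`. -/
def moebius (A : GL (Fin 2) ℚ) (z : OnePoint ℚ) : OnePoint ℚ :=
  Option.elim z
    (if A.val 1 0 = 0 then OnePoint.infty else ((A.val 0 0 / A.val 1 0 : ℚ) : OnePoint ℚ))
    (fun x => if A.val 1 0 * x + A.val 1 1 = 0 then OnePoint.infty
      else (((A.val 0 0 * x + A.val 0 1) / (A.val 1 0 * x + A.val 1 1) : ℚ) : OnePoint ℚ))

/-- `Δ(u²,2t)`: the subgroup of `PGL₂(ℚ)` generated by the images of the matrices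
`M₁ = [[t−1, u²],[1, 1]]` and `M₂ = [[u², u²],[1, t−u²]]`. -/
def Delta (u2 t : ℚ) : Subgroup PGL2Q :=
  Subgroup.closure (pgl ''
    {A : GL (Fin 2) ℚ | A.val = !![t - 1, u2; 1, 1] ∨ A.val = !![u2, u2; 1, t - u2]})

/-- The set `C(Γ)` of finite cusps of a subgroup `Γ ≤ PGL₂(ℚ)`: rationals fixed by a
parabolic element of `Γ` (an element `γ ≠ 1` with `tr(A)² = 4·det(A)` for a representative
`A ∈ GL₂(ℚ)`). -/
def finiteCusps (Γ : Subgroup PGL2Q) : Set ℚ :=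
  {x : ℚ | ∃ A : GL (Fin 2) ℚ, pgl A ∈ Γ ∧ pgl A ≠ 1 ∧
    (A.val.trace) ^ 2 = 4 * A.val.det ∧ moebius A (x : OnePoint ℚ) = (x : OnePoint ℚ)}


/-! ### A `p`-adic set of points stable under the generators -/

/-- For `u² = n / p`, the points `[a : c]` of `ℙ¹(ℚ)` which are `p`-adically close to one of the
four points `∞`, `-1`, `u²`, `0`. -/
def NearVertex (p n a c : ℤ) : Prop :=
  (¬ p ∣ a ∧ p ^ 2 ∣ c) ∨ (¬ p ∣ c ∧ p ∣ a + c) ∨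
    (∃ c', c = p * c' ∧ ¬ p ∣ c' ∧ p ∣ a - n * c') ∨ (¬ p ∣ c ∧ p ∣ a)

/-- The vector `(x, y)` is a nonzero multiple of an integral vector satisfying `NearVertex`. -/
def RatNearVertex (p n : ℤ) (x y : ℚ) : Prop :=
  ∃ k : ℚ, k ≠ 0 ∧ ∃ a c : ℤ, x = k * a ∧ y = k * c ∧ NearVertex p n a c

lemma not_dvd_of_eq_mul_add {p a b x e : ℤ} (hp : Prime p) (ha : ¬ p ∣ a) (hb : ¬ p ∣ b)
    (hx : x = a * b + p * e) : ¬ p ∣ x := by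
  intro h
  have : p ∣ a * b := by
    have h2 := dvd_sub h (Dvd.intro e rfl)
    rwa [hx, add_sub_cancel_right] at h2
  exact (hp.dvd_or_dvd this).elim ha hb

lemma not_dvd_neg_one {p : ℤ} (hp : Prime p) : ¬ p ∣ -1 := fun h =>
  hp.not_isUnit (isUnit_of_dvd_unit h (by simp))

section Stability

variable {p n s : ℤ} {x y x' y' d : ℚ}

lemma RatNearVertex.smul (h : RatNearVertex p n x y) (hd : d ≠ 0) (hx : x' = d * x)
    (hy : y' = d * y) : RatNearVertex p n x' y' := by
  obtain ⟨k, hk, a, c, rfl, rfl, h⟩ := h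
  exact ⟨d * k, mul_ne_zero hd hk, a, c, by rw [hx]; ring, by rw [hy]; ring, h⟩

lemma NearVertex.ratNearVertex {a c : ℤ} (h : NearVertex p n a c) (hd : d ≠ 0)
    (hx : x = d * a) (hy : y = d * c) : RatNearVertex p n x y :=
  ⟨d, hd, a, c, hx, hy, h⟩

lemma RatNearVertex.genOne (hp : Prime p) (hn : ¬ p ∣ n) (h : RatNearVertex p n x y) :
    RatNearVertex p n ((p * s - 1) * x + n / p * y) (x + y) := by
  have hp0 : (p : ℚ) ≠ 0 := by exact_mod_cast hp.ne_zero
  have h1 := not_dvd_neg_one hp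
  obtain ⟨k, hk, a, c, rfl, rfl, ⟨ha, c', rfl⟩ | ⟨hc, e, he⟩ | ⟨c', rfl, hc, e, he⟩ |
    ⟨hc, e, rfl⟩⟩ := h
  · refine NearVertex.ratNearVertex (d := k) (a := (p * s - 1) * a + n * p * c')
      (c := a + p ^ 2 * c') (Or.inr (Or.inl ⟨?_, ?_⟩)) hk ?_ ?_
    · exact not_dvd_of_eq_mul_add hp (a := -1) (b := -a) (e := p * c') h1 (by simpa using ha)
        (by ring)
    · exact ⟨s * a + n * c' + p * c', by ring⟩
    · push_cast; field_simp
    · push_cast; ring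
  · obtain rfl : a = p * e - c := by linarith
    refine NearVertex.ratNearVertex (d := k / p) (a := (p * s - 1) * (p * e - c) * p + n * c)
      (c := p ^ 2 * e) (Or.inl ⟨?_, ?_⟩) (div_ne_zero hk hp0) ?_ ?_
    · exact not_dvd_of_eq_mul_add hp (e := (p * s - 1) * (p * e - c)) hn hc (by ring)
    · exact ⟨e, by ring⟩
    · push_cast; field_simp
    · push_cast; field_simp; ring
  · obtain rfl : a = p * e + n * c' := by linarith
    refine NearVertex.ratNearVertex (d := k)
      (a := (p * s - 1) * (p * e + n * c') + n * c')
      (c := p * e + n * c' + p * c') (Or.inr (Or.inr (Or.inr ⟨?_, ?_⟩))) hk ?_ ?_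
    · exact not_dvd_of_eq_mul_add hp (e := e + c') hn hc (by ring)
    · exact ⟨s * (p * e + n * c') - e, by ring⟩
    · push_cast; field_simp
    · push_cast; ring
  · refine NearVertex.ratNearVertex (d := k / p) (a := (p * s - 1) * (p * e) * p + n * c)
      (c := p * (p * e + c)) (Or.inr (Or.inr (Or.inl ⟨p * e + c, rfl, ?_, ?_⟩)))
      (div_ne_zero hk hp0) ?_ ?_
    · exact not_dvd_of_eq_mul_add hp (a := -1) (b := -c) (e := e) h1 (by simpa using hc) (by ring)
    · exact ⟨(p * s - 1) * (p * e) - n * e, by ring⟩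
    · push_cast; field_simp
    · push_cast; field_simp

lemma RatNearVertex.genTwo (hp : Prime p) (hn : ¬ p ∣ n) (h : RatNearVertex p n x y) :
    RatNearVertex p n (n / p * x + n / p * y) (x + (p * s - n / p) * y) := by
  have hp0 : (p : ℚ) ≠ 0 := by exact_mod_cast hp.ne_zero
  obtain ⟨k, hk, a, c, rfl, rfl, ⟨ha, c', rfl⟩ | ⟨hc, e, he⟩ | ⟨c', rfl, hc, e, he⟩ |
    ⟨hc, e, rfl⟩⟩ := h
  · refine NearVertex.ratNearVertex (d := k / p) (a := n * (a + p ^ 2 * c'))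
      (c := p * (a + (p * (p * s) - n) * p * c'))
      (Or.inr (Or.inr (Or.inl ⟨_, rfl, ?_, ?_⟩))) (div_ne_zero hk hp0) ?_ ?_
    · exact not_dvd_of_eq_mul_add hp (a := -1) (b := -a) (e := (p * (p * s) - n) * c')
        (not_dvd_neg_one hp) (by simpa using ha) (by ring)
    · exact ⟨n * (p * c' - (p * (p * s) - n) * c'), by ring⟩
    · push_cast; field_simp
    · push_cast; field_simp
  · obtain rfl : a = p * e - c := by linarith
    refine NearVertex.ratNearVertex (d := k / p) (a := n * (p * e))
      (c := p * (p * e - c) + (p * (p * s) - n) * c) (Or.inr (Or.inr (Or.inr ⟨?_, ?_⟩)))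
      (div_ne_zero hk hp0) ?_ ?_
    · exact not_dvd_of_eq_mul_add hp (a := n) (b := -c) (e := p * e - c + p * s * c) hn
        (by simpa using hc) (by ring)
    · exact ⟨n * e, by ring⟩
    · push_cast; field_simp; ring
    · push_cast; field_simp
  · obtain rfl : a = p * e + n * c' := by linarith
    refine NearVertex.ratNearVertex (d := k / p) (a := n * (p * e + n * c' + p * c'))
      (c := p ^ 2 * (e + p * s * c'))
      (Or.inl ⟨?_, ?_⟩) (div_ne_zero hk hp0) ?_ ?_
    · refine not_dvd_of_eq_mul_add hp (a := n) (b := n * c') (e := n * (e + c')) hn ?_ (by ring)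
      exact fun h => (hp.dvd_or_dvd h).elim hn hc
    · exact ⟨_, rfl⟩
    · push_cast; field_simp
    · push_cast; field_simp; ring
  · refine NearVertex.ratNearVertex (d := k / p) (a := n * (p * e + c))
      (c := p * (p * e) + (p * (p * s) - n) * c) (Or.inr (Or.inl ⟨?_, ?_⟩))
      (div_ne_zero hk hp0) ?_ ?_
    · exact not_dvd_of_eq_mul_add hp (a := n) (b := -c) (e := p * e + p * s * c) hn
        (by simpa using hc) (by ring)
    · exact ⟨n * e + p * e + p * s * c, by ring⟩
    · push_cast; field_simp
    · push_cast; field_simp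

lemma RatNearVertex.genOneAdjugate (hp : Prime p) (hn : ¬ p ∣ n) (h : RatNearVertex p n x y) :
    RatNearVertex p n (x - n / p * y) (-x + (p * s - 1) * y) := by
  have hp0 : (p : ℚ) ≠ 0 := by exact_mod_cast hp.ne_zero
  have h1 := not_dvd_neg_one hp
  obtain ⟨k, hk, a, c, rfl, rfl, ⟨ha, c', rfl⟩ | ⟨hc, e, he⟩ | ⟨c', rfl, hc, e, he⟩ |
    ⟨hc, e, rfl⟩⟩ := h
  · refine NearVertex.ratNearVertex (d := k) (a := a - n * p * c')
      (c := -a + (p * s - 1) * p ^ 2 * c') (Or.inr (Or.inl ⟨?_, ?_⟩)) hk ?_ ?_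
    · exact not_dvd_of_eq_mul_add hp (a := -1) (b := a) (e := (p * s - 1) * p * c') h1 ha
        (by ring)
    · exact ⟨- n * c' + (p * s - 1) * p * c', by ring⟩
    · push_cast; field_simp
    · push_cast; ring
  · obtain rfl : a = p * e - c := by linarith
    refine NearVertex.ratNearVertex (d := k / p) (a := p * (p * e - c) - n * c)
      (c := p ^ 2 * (-e + s * c)) (Or.inl ⟨?_, ⟨_, rfl⟩⟩) (div_ne_zero hk hp0) ?_ ?_
    · exact not_dvd_of_eq_mul_add hp (a := n) (b := -c) (e := p * e - c) hn
        (by simpa using hc) (by ring)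
    · push_cast; field_simp
    · push_cast; field_simp; ring
  · obtain rfl : a = p * e + n * c' := by linarith
    refine NearVertex.ratNearVertex (d := k) (a := p * e)
      (c := -(p * e + n * c') + (p * s - 1) * (p * c'))
      (Or.inr (Or.inr (Or.inr ⟨?_, ⟨_, rfl⟩⟩))) hk ?_ ?_
    · exact not_dvd_of_eq_mul_add hp (a := n) (b := -c') (e := -e + (p * s - 1) * c') hn
        (by simpa using hc) (by ring)
    · push_cast; field_simp; ring
    · push_cast; ring
  · refine NearVertex.ratNearVertex (d := k / p) (a := p * (p * e) - n * c)
      (c := p * (-(p * e) + (p * s - 1) * c)) (Or.inr (Or.inr (Or.inl ⟨_, rfl, ?_, ?_⟩)))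
      (div_ne_zero hk hp0) ?_ ?_
    · exact not_dvd_of_eq_mul_add hp (a := -1) (b := c) (e := -e + s * c) h1 hc (by ring)
    · exact ⟨p * e + n * e - n * s * c, by ring⟩
    · push_cast; field_simp
    · push_cast; field_simp

lemma RatNearVertex.genTwoAdjugate (hp : Prime p) (hn : ¬ p ∣ n) (h : RatNearVertex p n x y) :
    RatNearVertex p n ((p * s - n / p) * x - n / p * y) (-x + n / p * y) := by
  have hp0 : (p : ℚ) ≠ 0 := by exact_mod_cast hp.ne_zero
  have h1 := not_dvd_neg_one hp
  obtain ⟨k, hk, a, c, rfl, rfl, ⟨ha, c', rfl⟩ | ⟨hc, e, he⟩ | ⟨c', rfl, hc, e, he⟩ |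
    ⟨hc, e, rfl⟩⟩ := h
  · refine NearVertex.ratNearVertex (d := k / p) (a := (p * p * s - n) * a - n * (p ^ 2 * c'))
      (c := p * (-a + n * p * c'))
      (Or.inr (Or.inr (Or.inl ⟨_, rfl, ?_, ?_⟩))) (div_ne_zero hk hp0) ?_ ?_
    · exact not_dvd_of_eq_mul_add hp (a := -1) (b := a) (e := n * c') h1 ha (by ring)
    · exact ⟨p * s * a - n * p * c' - n * n * c', by ring⟩
    · push_cast; field_simp
    · push_cast; field_simp
  · obtain rfl : a = p * e - c := by linarith
    refine NearVertex.ratNearVertex (d := k / p) (a := p * (p * s * (p * e - c) - n * e))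
      (c := -p * (p * e - c) + n * c) (Or.inr (Or.inr (Or.inr ⟨?_, ⟨_, rfl⟩⟩)))
      (div_ne_zero hk hp0) ?_ ?_
    · exact not_dvd_of_eq_mul_add hp (a := n) (b := c) (e := -(p * e - c)) hn hc (by ring)
    · push_cast; field_simp; ring
    · push_cast; field_simp
  · obtain rfl : a = p * e + n * c' := by linarith
    refine NearVertex.ratNearVertex (d := k / p)
      (a := (p * p * s - n) * (p * e + n * c') - n * p * c')
      (c := p ^ 2 * (-e)) (Or.inl ⟨?_, ⟨_, rfl⟩⟩) (div_ne_zero hk hp0) ?_ ?_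
    · refine not_dvd_of_eq_mul_add hp (a := n) (b := -(n * c'))
        (e := p * s * (p * e + n * c') - n * e - n * c') hn ?_ (by ring)
      rw [dvd_neg]
      exact fun h => (hp.dvd_or_dvd h).elim hn hc
    · push_cast; field_simp
    · push_cast; field_simp; ring
  · refine NearVertex.ratNearVertex (d := k / p) (a := (p * p * s - n) * (p * e) - n * c)
      (c := -p * (p * e) + n * c) (Or.inr (Or.inl ⟨?_, ?_⟩)) (div_ne_zero hk hp0) ?_ ?_
    · exact not_dvd_of_eq_mul_add hp (a := n) (b := c) (e := -(p * e)) hn hc (by ring)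
    · exact ⟨(p * p * s - n) * e - p * e, by ring⟩
    · push_cast; field_simp
    · push_cast; field_simp

lemma not_ratNearVertex_one_one (hp : Prime p) (hp2 : ¬ p ∣ 2) (hn : ¬ p ∣ n) :
    ¬ RatNearVertex p n 1 1 := by
  rintro ⟨k, hk, a, c, hx, hy, h⟩
  obtain rfl : a = c := by
    have : k * (a : ℚ) = k * c := hx.symm.trans hy
    exact_mod_cast mul_left_cancel₀ hk this
  obtain ⟨ha, hc⟩ | ⟨hc, h⟩ | ⟨c', rfl, hc, h⟩ | ⟨hc, h⟩ := h
  · exact ha ((dvd_pow_self p two_ne_zero).trans hc)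
  · rw [← two_mul] at h
    exact (hp.dvd_or_dvd h).elim hp2 hc
  · have h2 : p ∣ n * c' := (dvd_sub_right (dvd_mul_right p c')).1 h
    exact (hp.dvd_or_dvd h2).elim hn hc
  · exact hc h

lemma ratNearVertex_of_vertex (hp : Prime p) (h0 : x ≠ 0 ∨ y ≠ 0)
    (h : y = 0 ∨ x + y = 0 ∨ x - n / p * y = 0 ∨ x = 0) : RatNearVertex p n x y := by
  have hp0 : (p : ℚ) ≠ 0 := by exact_mod_cast hp.ne_zero
  have h1 : ¬ p ∣ 1 := fun h => hp.not_isUnit (isUnit_of_dvd_one h)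
  obtain rfl | h | h | rfl := h
  · exact ⟨x, by simpa using h0, 1, 0, by simp, by simp, Or.inl ⟨h1, by simp⟩⟩
  · obtain rfl : x = -y := by linarith
    exact ⟨y, by simpa using h0, -1, 1, by simp, by simp, Or.inr (Or.inl ⟨h1, by simp⟩)⟩
  · obtain rfl : x = n / p * y := by linarith
    have hy : y ≠ 0 := by rintro rfl; simp at h0
    exact ⟨y / p, div_ne_zero hy hp0, n, p, by field_simp, by field_simp,
      Or.inr (Or.inr (Or.inl ⟨1, by simp, h1, by simp⟩))⟩
  · exact ⟨y, by simpa using h0, 0, 1, by simp, by simp, Or.inr (Or.inr (Or.inr ⟨h1, by simp⟩))⟩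

end Stability

/-! ### Parabolic matrices -/

/-- `M` is a parabolic matrix (a scalar matrix plus a nonzero nilpotent one) fixing the line
spanned by `v`. -/
def IsParabolicAt (M : GL (Fin 2) ℚ) (v : Fin 2 → ℚ) : Prop :=
  v ≠ 0 ∧ ∃ μ κ : ℚ, κ ≠ 0 ∧
    ∀ w : Fin 2 → ℚ, M.val *ᵥ w = μ • w + (κ * (v 0 * w 1 - v 1 * w 0)) • v

lemma inv_mulVec_mulVec (M : GL (Fin 2) ℚ) (w : Fin 2 → ℚ) : (M⁻¹).val *ᵥ (M.val *ᵥ w) = w := by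
  rw [Matrix.mulVec_mulVec, ← Units.val_mul, inv_mul_cancel, Units.val_one, Matrix.one_mulVec]

lemma mulVec_inv_mulVec (M : GL (Fin 2) ℚ) (w : Fin 2 → ℚ) : M.val *ᵥ ((M⁻¹).val *ᵥ w) = w := by
  simpa using inv_mulVec_mulVec M⁻¹ w

lemma mulVec_ne_zero (M : GL (Fin 2) ℚ) {w : Fin 2 → ℚ} (hw : w ≠ 0) : M.val *ᵥ w ≠ 0 := by
  intro h
  apply hw
  rw [← inv_mulVec_mulVec M w, h, Matrix.mulVec_zero]

lemma IsParabolicAt.of_conj {M C : GL (Fin 2) ℚ} {v : Fin 2 → ℚ}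
    (h : IsParabolicAt (C * M * C⁻¹) v) : IsParabolicAt M ((C⁻¹).val *ᵥ v) := by
  obtain ⟨hv, μ, κ, hκ, h⟩ := h
  refine ⟨mulVec_ne_zero _ hv, μ, κ * C.val.det, mul_ne_zero hκ ?_, fun w => ?_⟩
  · exact (Matrix.isUnits_det_units C).ne_zero
  have h1 := congrArg (fun z => (C⁻¹).val *ᵥ z) (h (C.val *ᵥ w))
  simp only [Units.val_mul, ← Matrix.mulVec_mulVec, inv_mulVec_mulVec, Matrix.mulVec_add,
    Matrix.mulVec_smul] at h1
  rw [h1]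
  congr 2
  rw [mul_assoc]
  congr 1
  conv_lhs => rw [← mulVec_inv_mulVec C v]
  simp only [Matrix.mulVec, dotProduct, Fin.sum_univ_two, Matrix.det_fin_two]
  ring

lemma IsParabolicAt.exists_mulVec_eq_smul {M : GL (Fin 2) ℚ} {v : Fin 2 → ℚ}
    (h : IsParabolicAt M v) : ∃ μ κ : ℚ, μ ≠ 0 ∧ κ ≠ 0 ∧ M.val *ᵥ v = μ • v ∧
      ∀ w : Fin 2 → ℚ, M.val *ᵥ w = μ • w + (κ * (v 0 * w 1 - v 1 * w 0)) • v := by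
  obtain ⟨hv, μ, κ, hκ, h⟩ := h
  have hMv : M.val *ᵥ v = μ • v := by rw [h v, mul_comm (v 0), sub_self]; simp
  refine ⟨μ, κ, ?_, hκ, hMv, h⟩
  rintro rfl
  exact mulVec_ne_zero M hv (by rw [hMv, zero_smul])

lemma IsParabolicAt.inv {M : GL (Fin 2) ℚ} {v : Fin 2 → ℚ} (h : IsParabolicAt M v) :
    IsParabolicAt M⁻¹ v := by
  obtain ⟨μ, κ, hμ, hκ, hMv, hM⟩ := h.exists_mulVec_eq_smul
  have hv' : (M⁻¹).val *ᵥ v = μ⁻¹ • v := by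
    have := congrArg (fun z => μ⁻¹ • (M⁻¹).val *ᵥ z) hMv
    simp only [inv_mulVec_mulVec, Matrix.mulVec_smul, smul_smul, inv_mul_cancel₀ hμ,
      one_smul] at this
    exact this.symm
  refine ⟨h.1, μ⁻¹, -κ / μ ^ 2, by simp [hκ, hμ], fun w => ?_⟩
  have h1 := congrArg (fun z => (M⁻¹).val *ᵥ z) (hM w)
  simp only [inv_mulVec_mulVec, Matrix.mulVec_add, Matrix.mulVec_smul, hv'] at h1
  ext i
  have h2 := congrFun h1 i
  simp only [Pi.add_apply, Pi.smul_apply, smul_eq_mul] at h2 ⊢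
  generalize ((M⁻¹).val *ᵥ w) i = z at *
  field_simp at h2 ⊢
  linear_combination -h2

lemma not_isParabolicAt_one (v : Fin 2 → ℚ) : ¬ IsParabolicAt 1 v := by
  rintro ⟨hv, μ, κ, hκ, h⟩
  have hμ : v = μ • v := by simpa [mul_comm (v 0)] using h v
  have h1 := h ![-v 1, v 0]
  simp only [Units.val_one, Matrix.one_mulVec] at h1
  have e0 := congrFun hμ 0
  have e1 := congrFun hμ 1
  have f0 := congrFun h1 0
  have f1 := congrFun h1 1
  simp only [Pi.add_apply, Pi.smul_apply, smul_eq_mul, Matrix.cons_val_zero,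
    Matrix.cons_val_one] at e0 e1 f0 f1
  have g0 : κ * (v 0 * v 0 + v 1 * v 1) * v 0 = 0 := by linear_combination -f0 - e1
  have g1 : κ * (v 0 * v 0 + v 1 * v 1) * v 1 = 0 := by linear_combination -f1 + e0
  have g : κ * (v 0 * v 0 + v 1 * v 1) ^ 2 = 0 := by linear_combination v 0 * g0 + v 1 * g1
  have g2 : v 0 * v 0 + v 1 * v 1 = 0 := by simpa [hκ] using g
  apply hv
  ext i
  fin_cases i
  · simp; nlinarith [mul_self_nonneg (v 0), mul_self_nonneg (v 1)]
  · simp; nlinarith [mul_self_nonneg (v 0), mul_self_nonneg (v 1)]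

/-- A parabolic matrix maps no open arc around its fixed point onto a superset of itself. -/
lemma IsParabolicAt.false_of_invariant {M : GL (Fin 2) ℚ} {v : Fin 2 → ℚ}
    (h : IsParabolicAt M v) {q : (Fin 2 → ℚ) → ℚ} (a₁ b₁ a₂ b₂ : ℚ)
    (hq : ∀ w, q w = (a₁ * w 0 + b₁ * w 1) * (a₂ * w 0 + b₂ * w 1))
    (hv : 0 < q v) (hM : ∀ w, q w ≤ 0 → q (M.val *ᵥ w) ≤ 0) : False := by
  obtain ⟨-, μ, κ, hκ, h⟩ := h
  have h1 := hM ![b₁, -a₁] (le_of_eq (by simp only [hq, Matrix.cons_val_zero, Matrix.cons_val_one]; ring))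
  have h2 := hM ![b₂, -a₂] (le_of_eq (by simp only [hq, Matrix.cons_val_zero, Matrix.cons_val_one]; ring))
  rw [hq] at hv
  rw [h, hq] at h1 h2
  simp only [Pi.add_apply, Pi.smul_apply, smul_eq_mul, Matrix.cons_val_zero,
    Matrix.cons_val_one] at h1 h2
  set l₁ := a₁ * v 0 + b₁ * v 1 with hl₁
  set l₂ := a₂ * v 0 + b₂ * v 1 with hl₂
  have k1 : l₁ ^ 2 * (-(μ * κ * (a₂ * b₁ - b₂ * a₁)) + κ ^ 2 * (l₁ * l₂)) ≤ 0 := by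
    refine le_of_eq_of_le ?_ h1
    rw [hl₁, hl₂]; ring
  have k2 : l₂ ^ 2 * (μ * κ * (a₂ * b₁ - b₂ * a₁) + κ ^ 2 * (l₁ * l₂)) ≤ 0 := by
    refine le_of_eq_of_le ?_ h2
    rw [hl₁, hl₂]; ring
  have n1 : 0 < l₁ ^ 2 := by
    have := left_ne_zero_of_mul hv.ne'
    positivity
  have n2 : 0 < l₂ ^ 2 := by
    have := right_ne_zero_of_mul hv.ne'
    positivity
  have n3 : 0 < κ ^ 2 * (l₁ * l₂) := by positivity
  have m1 := nonpos_of_mul_nonpos_right k1 n1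
  have m2 := nonpos_of_mul_nonpos_right k2 n2
  linarith

/-! ### Ping-pong for the ideal quadrilateral with vertices `∞, -1, 0, u²` -/

/-- Quadratic forms which are positive exactly on the four open arcs of `ℙ¹` cut out by the
points `∞, -1, 0, u²`, indexed by the letters of a free group on two generators. -/
def arcForm (u : ℚ) : Bool × Bool → (Fin 2 → ℚ) → ℚ
  | (true, true), w => (w 0 - u * w 1) * w 1
  | (true, false), w => -((w 0 + w 1) * w 0)
  | (false, true), w => -(w 0 * (w 0 - u * w 1))
  | (false, false), w => -((w 0 + w 1) * w 1)

lemma arcForm_eq_mul (u : ℚ) (a : Bool × Bool) : ∃ a₁ b₁ a₂ b₂ : ℚ, ∀ w : Fin 2 → ℚ,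
    arcForm u a w = (a₁ * w 0 + b₁ * w 1) * (a₂ * w 0 + b₂ * w 1) := by
  obtain ⟨_ | _, _ | _⟩ := a
  · exact ⟨-1, -1, 0, 1, fun w => by simp only [arcForm]; ring⟩
  · exact ⟨-1, 0, 1, -u, fun w => by simp only [arcForm]; ring⟩
  · exact ⟨-1, -1, 1, 0, fun w => by simp only [arcForm]; ring⟩
  · exact ⟨1, -u, 0, 1, fun w => by simp only [arcForm]; ring⟩

lemma vertex_of_arcForm_eq_zero {u : ℚ} {a : Bool × Bool} {w : Fin 2 → ℚ}
    (h : arcForm u a w = 0) :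
    w 1 = 0 ∨ w 0 + w 1 = 0 ∨ w 0 - u * w 1 = 0 ∨ w 0 = 0 := by
  obtain ⟨_ | _, _ | _⟩ := a <;> simp only [arcForm, neg_eq_zero, mul_eq_zero] at h <;> tauto

lemma arcForm_nonpos_of_nonneg {u : ℚ} (hu : 0 < u) {a b : Bool × Bool} (hab : a ≠ b)
    {w : Fin 2 → ℚ} (h : 0 ≤ arcForm u a w) : arcForm u b w ≤ 0 := by
  obtain ⟨_ | _, _ | _⟩ := a <;> obtain ⟨_ | _, _ | _⟩ := b <;>
    first
    | exact absurd rfl hab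
    | (simp only [arcForm] at h ⊢
       generalize w 0 = x at *
       generalize w 1 = y at *
       by_contra! hc
       nlinarith [mul_nonneg hu.le h, mul_pos hu hc, mul_nonneg hu.le (mul_self_nonneg x),
         mul_nonneg hu.le (mul_self_nonneg y), mul_self_nonneg x, mul_self_nonneg y,
         mul_self_nonneg (x + y), mul_self_nonneg (x - u * y)])

section PingPong

variable {t u : ℚ} {f : Bool → GL (Fin 2) ℚ}

/-- The matrix attached to a letter of the free group on two generators. -/
def letter (f : Bool → GL (Fin 2) ℚ) (a : Bool × Bool) : GL (Fin 2) ℚ :=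
  cond a.2 (f a.1) (f a.1)⁻¹

lemma exists_arcForm_letter (h0 : 0 < u) (h1 : u < t - 1)
    (hA : (f true).val = !![t - 1, u; 1, 1]) (hB : (f false).val = !![u, u; 1, t - u])
    (a : Bool × Bool) : ∃ c : ℚ, 0 < c ∧ ∀ w : Fin 2 → ℚ,
      arcForm u a ((letter f a).val *ᵥ w) = -c * arcForm u (a.1, !a.2) w := by
  have hd : 0 < t - 1 - u := by linarith
  have key : ∀ i : Bool, ∃ c : ℚ, 0 < c ∧ ∀ w : Fin 2 → ℚ,
      arcForm u (i, true) ((f i).val *ᵥ w) = -c * arcForm u (i, false) w := by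
    rintro (_ | _)
    · refine ⟨u ^ 2 * (t - 1 - u), by positivity, fun w => ?_⟩
      simp only [hB, arcForm, Matrix.mulVec, dotProduct, Fin.sum_univ_two]
      simp
      ring
    · refine ⟨t - 1 - u, hd, fun w => ?_⟩
      simp only [hA, arcForm, Matrix.mulVec, dotProduct, Fin.sum_univ_two]
      simp
      ring
  obtain ⟨i, _ | _⟩ := a <;> obtain ⟨c, hc, h⟩ := key i
  · refine ⟨c⁻¹, by positivity, fun w => ?_⟩
    have h2 := h ((f i)⁻¹.val *ᵥ w)
    rw [mulVec_inv_mulVec] at h2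
    simp only [letter, cond_false, Bool.not_false, h2]
    field_simp
  · exact ⟨c, hc, h⟩

lemma arcForm_prod_nonneg (h0 : 0 < u) (h1 : u < t - 1)
    (hA : (f true).val = !![t - 1, u; 1, 1]) (hB : (f false).val = !![u, u; 1, t - u]) :
    ∀ (L : List (Bool × Bool)) (a b : Bool × Bool), FreeGroup.IsReduced L →
      a ∈ L.head? → b ∈ L.getLast? → ∀ w : Fin 2 → ℚ, arcForm u (b.1, !b.2) w ≤ 0 →
      0 ≤ arcForm u a ((L.map (letter f)).prod.val *ᵥ w) := by
  intro L
  induction L with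
  | nil => simp
  | cons x L ih =>
    intro a b hL ha hb w hw
    obtain rfl : x = a := by simpa using ha
    have step : ∀ z, arcForm u (x.1, !x.2) z ≤ 0 →
        0 ≤ arcForm u x ((letter f x).val *ᵥ z) := by
      intro z hz
      obtain ⟨c, hc, h⟩ := exists_arcForm_letter h0 h1 hA hB x
      rw [h]
      nlinarith
    cases L with
    | nil =>
      obtain rfl : x = b := by simpa using hb
      simpa using step w hw
    | cons y L =>
      rw [FreeGroup.isReduced_cons_cons] at hL
      have := ih y b hL.2 (by simp) (by simpa using hb) w hw
      rw [List.map_cons, List.prod_cons, Units.val_mul, ← Matrix.mulVec_mulVec]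
      refine step _ (arcForm_nonpos_of_nonneg h0 ?_ this)
      rintro rfl
      simpa using hL.1 rfl

lemma isReduced_invRev {L : List (Bool × Bool)} (h : FreeGroup.IsReduced L) :
    FreeGroup.IsReduced (FreeGroup.invRev L) := by
  rw [FreeGroup.isReduced_iff_reduce_eq] at h ⊢
  rw [FreeGroup.reduce_invRev, h]

lemma prod_letter_eq_lift (L : List (Bool × Bool)) :
    (L.map (letter f)).prod = FreeGroup.lift f (FreeGroup.mk L) :=
  FreeGroup.lift_mk.symm

lemma vertex_of_isParabolicAt_of_isCyclicallyReduced (h0 : 0 < u) (h1 : u < t - 1)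
    (hA : (f true).val = !![t - 1, u; 1, 1]) (hB : (f false).val = !![u, u; 1, t - u])
    {L : List (Bool × Bool)} (hL : FreeGroup.IsCyclicallyReduced L) {v : Fin 2 → ℚ}
    (h : IsParabolicAt (FreeGroup.lift f (FreeGroup.mk L)) v) :
    v 1 = 0 ∨ v 0 + v 1 = 0 ∨ v 0 - u * v 1 = 0 ∨ v 0 = 0 := by
  rcases eq_or_ne L [] with rfl | hne
  · exact absurd h (by rw [← FreeGroup.one_eq_mk, map_one]; exact not_isParabolicAt_one v)
  obtain ⟨a, ha⟩ : ∃ a, a ∈ L.head? := ⟨L.head hne, by simp [List.head?_eq_some_head hne]⟩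
  obtain ⟨b, hb⟩ : ∃ b, b ∈ L.getLast? := ⟨L.getLast hne, by
    simp [List.getLast?_eq_some_getLast hne]⟩
  have hab : a ≠ (b.1, !b.2) := by
    rintro rfl
    simpa using hL.2 b hb _ ha rfl
  have hM := arcForm_prod_nonneg h0 h1 hA hB L a b hL.1 ha hb
  have hM' := arcForm_prod_nonneg h0 h1 hA hB (FreeGroup.invRev L) (b.1, !b.2) (a.1, !a.2)
    (isReduced_invRev hL.1)
    (by simp only [Option.mem_def] at hb ⊢; simp [FreeGroup.invRev, hb])
    (by simp only [Option.mem_def] at ha ⊢; simp [FreeGroup.invRev, ha])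
  simp only [prod_letter_eq_lift, ← FreeGroup.inv_mk, map_inv, Bool.not_not] at hM hM'
  set M := FreeGroup.lift f (FreeGroup.mk L)
  have na : ¬ 0 < arcForm u a v := by
    intro hpos
    obtain ⟨a₁, b₁, a₂, b₂, hq⟩ := arcForm_eq_mul u a
    exact h.inv.false_of_invariant a₁ b₁ a₂ b₂ hq hpos fun w hw =>
      arcForm_nonpos_of_nonneg h0 hab.symm (hM' w hw)
  have nb : ¬ 0 < arcForm u (b.1, !b.2) v := by
    intro hpos
    obtain ⟨a₁, b₁, a₂, b₂, hq⟩ := arcForm_eq_mul u (b.1, !b.2)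
    exact h.false_of_invariant a₁ b₁ a₂ b₂ hq hpos fun w hw =>
      arcForm_nonpos_of_nonneg h0 hab (hM w hw)
  have hfix := hM v (not_lt.1 nb)
  obtain ⟨μ, κ, hμ, -, hMv, -⟩ := h.exists_mulVec_eq_smul
  obtain ⟨a₁, b₁, a₂, b₂, hq⟩ := arcForm_eq_mul u a
  have : arcForm u a (M.val *ᵥ v) = μ ^ 2 * arcForm u a v := by
    rw [hMv, hq, hq]
    simp only [Pi.smul_apply, smul_eq_mul]
    ring
  rw [this] at hfix
  have : 0 ≤ arcForm u a v := nonneg_of_mul_nonneg_right hfix (by positivity)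
  exact vertex_of_arcForm_eq_zero (le_antisymm (not_lt.1 na) this)

end PingPong

section Cusps

variable {t u : ℚ} {f : Bool → GL (Fin 2) ℚ}

lemma ratNearVertex_lift {p n s : ℤ} (hp : Prime p) (hn : ¬ p ∣ n) (hu : u = n / p)
    (ht : t = p * s) (h1 : u < t - 1)
    (hA : (f true).val = !![t - 1, u; 1, 1]) (hB : (f false).val = !![u, u; 1, t - u])
    (h0 : 0 < u) (g : FreeGroup Bool) {v : Fin 2 → ℚ} (hv : RatNearVertex p n (v 0) (v 1)) :
    RatNearVertex p n (((FreeGroup.lift f g).val *ᵥ v) 0) (((FreeGroup.lift f g).val *ᵥ v) 1) := by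
  have hd : t - 1 - u ≠ 0 := by linarith
  induction g using FreeGroup.induction_on generalizing v with
  | C1 => simpa using hv
  | of i =>
    rw [FreeGroup.lift_apply_of]
    cases i
    · refine (hv.genTwo (s := s) hp hn).smul one_ne_zero ?_ ?_ <;>
        simp [hB, Matrix.mulVec, dotProduct, Fin.sum_univ_two, hu, ht]
    · refine (hv.genOne (s := s) hp hn).smul one_ne_zero ?_ ?_ <;>
        simp [hA, Matrix.mulVec, dotProduct, Fin.sum_univ_two, hu, ht]
  | inv_of i _ =>
    rw [map_inv, FreeGroup.lift_apply_of]
    set w := (f i)⁻¹.val *ᵥ v with hw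
    have hvw : v = (f i).val *ᵥ w := (mulVec_inv_mulVec _ _).symm
    have e0 := congrFun hvw 0
    have e1 := congrFun hvw 1
    cases i
    · simp [hB, Matrix.mulVec, dotProduct, Fin.sum_univ_two] at e0 e1
      refine (hv.genTwoAdjugate (s := s) hp hn).smul (d := (u * (t - 1 - u))⁻¹) (by positivity)
        ?_ ?_
      · rw [← hu, ← ht, e0, e1]; field_simp; ring
      · rw [← hu, e0, e1]; field_simp; ring
    · simp [hA, Matrix.mulVec, dotProduct, Fin.sum_univ_two] at e0 e1
      refine (hv.genOneAdjugate (s := s) hp hn).smul (d := (t - 1 - u)⁻¹) (by positivity)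
        ?_ ?_
      · rw [← hu, e0, e1]; field_simp; ring
      · rw [← ht, e0, e1]; field_simp; ring
  | mul x y hx hy =>
    rw [map_mul, Units.val_mul, ← Matrix.mulVec_mulVec]
    exact hx (hy hv)

lemma ratNearVertex_of_isParabolicAt {p n s : ℤ} (hp : Prime p) (hn : ¬ p ∣ n)
    (hu : u = n / p) (ht : t = p * s) (h0 : 0 < u) (h1 : u < t - 1)
    (hA : (f true).val = !![t - 1, u; 1, 1]) (hB : (f false).val = !![u, u; 1, t - u])
    (g : FreeGroup Bool) {v : Fin 2 → ℚ} (hv : IsParabolicAt (FreeGroup.lift f g) v) :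
    RatNearVertex p n (v 0) (v 1) := by
  set C := FreeGroup.reduceCyclically.conjugator g.toWord
  set R := FreeGroup.reduceCyclically g.toWord
  have hg : g = FreeGroup.mk C * FreeGroup.mk R * (FreeGroup.mk C)⁻¹ := by
    rw [FreeGroup.inv_mk, FreeGroup.mul_mk, FreeGroup.mul_mk,
      FreeGroup.reduceCyclically.conj_conjugator_reduceCyclically, FreeGroup.mk_toWord]
  rw [hg, map_mul, map_mul, map_inv] at hv
  have hR := hv.of_conj
  have hvert := vertex_of_isParabolicAt_of_isCyclicallyReduced h0 h1 hA hB
    (FreeGroup.reduceCyclically.isCyclicallyReduced FreeGroup.isReduced_toWord) hR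
  have hne := hR.1
  set w := ((FreeGroup.lift f (FreeGroup.mk C))⁻¹).val *ᵥ v with hw
  have hnear : RatNearVertex p n (w 0) (w 1) := by
    refine ratNearVertex_of_vertex hp ?_ (hu ▸ hvert)
    by_contra! h
    exact hne (by ext i; fin_cases i; exacts [h.1, h.2])
  have := ratNearVertex_lift hp hn hu ht h1 hA hB h0 (FreeGroup.mk C) hnear
  rwa [hw, mulVec_inv_mulVec] at this

lemma exists_lift_eq_of_pgl_mem_Delta
    (hA : (f true).val = !![t - 1, u; 1, 1]) (hB : (f false).val = !![u, u; 1, t - u])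
    {A : GL (Fin 2) ℚ} (h : pgl A ∈ Delta u t) :
    ∃ (g : FreeGroup Bool) (r : ℚ), (FreeGroup.lift f g).val = r • A.val := by
  have hle : Delta u t ≤ (FreeGroup.lift f).range.map pgl := by
    rw [Delta, Subgroup.closure_le]
    rintro _ ⟨M, hM | hM, rfl⟩
    · exact ⟨f true, ⟨FreeGroup.of true, by simp⟩, by rw [Units.ext (hM.trans hA.symm)]⟩
    · exact ⟨f false, ⟨FreeGroup.of false, by simp⟩, by rw [Units.ext (hM.trans hB.symm)]⟩
  obtain ⟨_, ⟨g, rfl⟩, hg⟩ := hle h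
  obtain ⟨r, hr⟩ := GeneralLinearGroup.mem_center_iff_val_mem_range_scalar.1
    (QuotientGroup.eq.1 hg.symm)
  refine ⟨g, r, ?_⟩
  have : (FreeGroup.lift f g).val = A.val * (A⁻¹ * FreeGroup.lift f g).val := by
    rw [← Units.val_mul, mul_inv_cancel_left]
  rw [this, ← hr]
  ext i j
  simp [mul_comm]

lemma val_ne_scalar_of_pgl_ne_one {A : GL (Fin 2) ℚ} (h : pgl A ≠ 1) (r : ℚ) :
    A.val ≠ Matrix.scalar (Fin 2) r := fun hr =>
  h ((QuotientGroup.eq_one_iff A).2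
    (GeneralLinearGroup.mem_center_iff_val_mem_range_scalar.2 ⟨r, hr.symm⟩))

/-- A parabolic element fixing the point `1` has the expected normal form. -/
lemma exists_mulVec_eq_of_moebius_one {A : GL (Fin 2) ℚ} (hA : pgl A ≠ 1)
    (htr : A.val.trace ^ 2 = 4 * A.val.det)
    (hfix : moebius A ((1 : ℚ) : OnePoint ℚ) = ((1 : ℚ) : OnePoint ℚ)) :
    ∃ μ κ : ℚ, κ ≠ 0 ∧ ∀ w : Fin 2 → ℚ,
      A.val *ᵥ w = μ • w + (κ * (w 1 - w 0)) • ![1, 1] := by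
  have hsum : A.val 0 0 + A.val 0 1 = A.val 1 0 + A.val 1 1 := by
    change (if A.val 1 0 * 1 + A.val 1 1 = 0 then OnePoint.infty
      else (((A.val 0 0 * 1 + A.val 0 1) / (A.val 1 0 * 1 + A.val 1 1) : ℚ) : OnePoint ℚ)) = _
      at hfix
    split_ifs at hfix with h
    · exact absurd hfix.symm (OnePoint.coe_ne_infty 1)
    · have := OnePoint.coe_injective hfix
      rw [div_eq_one_iff_eq h] at this
      linarith
  rw [Matrix.trace_fin_two, Matrix.det_fin_two] at htr
  have hbc : A.val 0 1 = -A.val 1 0 := by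
    have : (A.val 0 1 + A.val 1 0) ^ 2 = 0 := by
      have h00 : A.val 0 0 = A.val 1 0 + A.val 1 1 - A.val 0 1 := by linarith
      rw [h00] at htr
      linear_combination htr
    have := pow_eq_zero_iff two_ne_zero |>.1 this
    linarith
  refine ⟨A.val 0 0 - A.val 1 0, -A.val 1 0, ?_, fun w => ?_⟩
  · intro h
    refine val_ne_scalar_of_pgl_ne_one hA (A.val 0 0) ?_
    ext i j
    fin_cases i <;> fin_cases j <;> simp <;> linarith
  · ext i
    fin_cases i
    · simp [Matrix.mulVec, dotProduct, Fin.sum_univ_two]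
      linear_combination w 1 * hbc
    · simp [Matrix.mulVec, dotProduct, Fin.sum_univ_two]
      linear_combination (-w 1) * hsum + w 1 * hbc

end Cusps

/-- **Proposition 5(b).** Let `t` be an integer, `0 < u² < t − 1`, and suppose the
finite cusp set of `Δ(u²,2t)` is all of `ℚ`. If the denominator of `u²` is an odd prime `p`,
then `p` does not divide `t`. -/
theorem odd_prime_denom_not_dvd_of_cusps_eq_univ (t : ℤ) (u2 : ℚ)
    (h0 : 0 < u2) (h1 : u2 < (t : ℚ) - 1)
    (hcusps : finiteCusps (Delta u2 (t : ℚ)) = Set.univ)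
    (p : ℕ) (hp : p.Prime) (hodd : Odd p) (hden : u2.den = p) :
    ¬ (p : ℤ) ∣ t := by
  rintro ⟨s, rfl⟩
  have hpp : Prime (p : ℤ) := Nat.prime_iff_prime_int.1 hp
  have hp2 : ¬ (p : ℤ) ∣ 2 := by
    intro h
    have : p ∣ 2 := by exact_mod_cast h
    obtain rfl := (Nat.prime_dvd_prime_iff_eq hp Nat.prime_two).1 this
    exact absurd hodd (by decide)
  have hn : ¬ (p : ℤ) ∣ u2.num := by
    intro h
    have h2 : p ∣ u2.num.natAbs := Int.natCast_dvd.1 h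
    have h3 : p ∣ 1 := by
      rw [← u2.reduced.gcd_eq_one]
      exact Nat.dvd_gcd h2 hden.symm.dvd
    exact hp.one_lt.ne' (Nat.dvd_one.1 h3)
  have hu : u2 = (u2.num : ℚ) / ((p : ℤ) : ℚ) := by
    rw [Int.cast_natCast, ← hden, Rat.num_div_den]
  have ht : (((p * s : ℤ)) : ℚ) = ((p : ℤ) : ℚ) * s := by push_cast; ring
  set t : ℚ := ((p * s : ℤ) : ℚ)
  have hd : 0 < t - 1 - u2 := by linarith
  let f : Bool → GL (Fin 2) ℚ := fun i => cond i
    (GeneralLinearGroup.mkOfDetNeZero !![t - 1, u2; 1, 1]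
      (by rw [Matrix.det_fin_two_of]; linarith))
    (GeneralLinearGroup.mkOfDetNeZero !![u2, u2; 1, t - u2]
      (by rw [Matrix.det_fin_two_of]; nlinarith [mul_pos h0 hd]))
  have hA : (f true).val = !![t - 1, u2; 1, 1] := rfl
  have hB : (f false).val = !![u2, u2; 1, t - u2] := rfl
  obtain ⟨A, hmem, hne, htr, hfix⟩ : (1 : ℚ) ∈ finiteCusps (Delta u2 t) := by
    rw [hcusps]; exact Set.mem_univ _
  obtain ⟨g, r, hg⟩ := exists_lift_eq_of_pgl_mem_Delta hA hB hmem
  obtain ⟨μ, κ, hκ, hw⟩ := exists_mulVec_eq_of_moebius_one hne htr hfix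
  have hr : r ≠ 0 := by
    rintro rfl
    exact (FreeGroup.lift f g).ne_zero (by rw [hg, zero_smul])
  have hpar : IsParabolicAt (FreeGroup.lift f g) ![1, 1] := by
    refine ⟨fun h => by simpa using congrFun h 0, r * μ, r * κ, mul_ne_zero hr hκ, fun w => ?_⟩
    rw [hg, Matrix.smul_mulVec, hw, smul_add, smul_smul, smul_smul]
    simp [mul_assoc]
  exact not_ratNearVertex_one_one hpp hp2 hn
    (ratNearVertex_of_isParabolicAt hpp hn hu ht h0 h1 hA hB g hpar)
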